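/- arXiv:1312.6165 — 2 statements merged into one kernel-verified Lean document; each statement's English description precedes it below -/
import Mathlib

section
/- There exists a constant C̃_ξ, depending only on C_A, K_B, M_B and T, such that for all y, k, h ∈ E and all t ∈ [t₀,T], ‖ξ^{t₀,y+k}(t)h − ξ^{t₀,y}(t)h‖ ≤ C̃_ξ ‖h‖ ‖k‖; that is, y ↦ ξ^{t₀,y}(t) is Lipschitz continuous from E to L(E,E), uniformly in t. -/
open MeasureTheory

/-- Operator spaces are equipped with the Borel σ-algebra of the norm topology. -/
noncomputable instance (priority := 100) {E F : Type*} [NormedAddCommGroup E]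
    [NormedSpace ℝ E] [NormedAddCommGroup F] [NormedSpace ℝ F] :
    MeasurableSpace (E →L[ℝ] F) := borel _

/-- A function `[t₀,T] → E` which is measurable and bounded. -/
def BddMeasOn {E : Type u} [NormedAddCommGroup E] [MeasurableSpace E]
    (f : ℝ → E) (t₀ T : ℝ) : Prop :=
  Measurable (fun t : Set.Icc t₀ T => f t) ∧ ∃ M, ∀ t ∈ Set.Icc t₀ T, ‖f t‖ ≤ M

/-- `Y` is a mild solution on `[t₀,T]` of `dY = AY dt + B(t,Y) dt + dz`. -/
def IsMildSolution {E : Type u} [NormedAddCommGroup E] [NormedSpace ℝ E]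
    (S : ℝ → E →L[ℝ] E) (B : ℝ → E → E) (t₀ T : ℝ)
    (y : E) (z : ℝ → E) (Y : ℝ → E) : Prop :=
  ∀ t ∈ Set.Icc t₀ T,
    Y t = S (t - t₀) y + (∫ s in t₀..t, S (t - s) (B s (Y s))) + z t

/-- `ξ` solves the first variation equation along `Y` on `[t₀,T]`. -/
def IsFirstVariation {E : Type u} [NormedAddCommGroup E] [NormedSpace ℝ E]
    (S : ℝ → E →L[ℝ] E) (DB : ℝ → E → E →L[ℝ] E) (t₀ T : ℝ)
    (Y : ℝ → E) (ξ : ℝ → E →L[ℝ] E) : Prop :=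
  ∀ t ∈ Set.Icc t₀ T, ∀ h : E,
    ξ t h = S (t - t₀) h + ∫ s in t₀..t, S (t - s) (DB s (Y s) (ξ s h))

/-- A closed set whose image under a continuous map is uncountable contains two small closed
sets with disjoint images that are still uncountable. -/
theorem IsClosed.exists_splitting_of_not_countable_image {β γ : Type*} [MetricSpace β]
    [SecondCountableTopology β] [TopologicalSpace γ] [T25Space γ] {h : β → γ} (hc : Continuous h)
    {C : Set β} (hC : IsClosed C) (hunc : ¬(h '' C).Countable) {ε : ENNReal} (hε : 0 < ε) :
    ∃ D : Bool → Set β, (∀ b, IsClosed (D b) ∧ ¬(h '' D b).Countable ∧ D b ⊆ C ∧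
      Metric.ediam (D b) ≤ ε) ∧ Disjoint (h '' D false) (h '' D true) := by
  classical
  let W : Set β := {x ∈ C | ∀ N ∈ nhds x, ¬(h '' (C ∩ N)).Countable}
  have hCW : (h '' (C \ W)).Countable := by
    have key : ∀ x ∈ C \ W, ∃ N ∈ nhds x, (h '' (C ∩ N)).Countable := by
      intro x hx
      by_contra! hcon
      exact hx.2 ⟨hx.1, hcon⟩
    choose! N hN hN' using key
    obtain ⟨t, ht, htc, hcov⟩ := TopologicalSpace.countable_cover_nhdsWithin
      (fun x hx => mem_nhdsWithin_of_mem_nhds (hN x hx))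
    refine (htc.biUnion fun x hx => hN' x (ht hx)).mono ?_
    rintro _ ⟨x, hx, rfl⟩
    obtain ⟨i, hi, hxi⟩ := Set.mem_iUnion₂.1 (hcov hx)
    exact Set.mem_iUnion₂.2 ⟨i, hi, x, ⟨hx.1, hxi⟩, rfl⟩
  have hW : (h '' W).Nontrivial := by
    by_contra hcon
    rw [Set.not_nontrivial_iff] at hcon
    refine hunc ((hcon.countable.union hCW).mono ?_)
    rw [← Set.image_union]
    exact Set.image_mono fun x hx => (em (x ∈ W)).imp id fun hxW => ⟨hx, hxW⟩
  obtain ⟨_, ⟨x, hx, rfl⟩, _, ⟨y, hy, rfl⟩, hxy⟩ := hW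
  obtain ⟨U, hU, V, hV, hUV⟩ := exists_nhds_disjoint_closure hxy
  have aux : ∀ z ∈ W, ∀ N ∈ nhds (h z),
      IsClosed (C ∩ (Metric.closedEBall z (ε / 2) ∩ h ⁻¹' closure N)) ∧
      ¬(h '' (C ∩ (Metric.closedEBall z (ε / 2) ∩ h ⁻¹' closure N))).Countable ∧
      C ∩ (Metric.closedEBall z (ε / 2) ∩ h ⁻¹' closure N) ⊆ C ∧
      Metric.ediam (C ∩ (Metric.closedEBall z (ε / 2) ∩ h ⁻¹' closure N)) ≤ ε := by
    intro z hz N hN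
    refine ⟨hC.inter (Metric.isClosed_closedEBall.inter (isClosed_closure.preimage hc)), ?_,
      Set.inter_subset_left, ?_⟩
    · refine hz.2 _ (Filter.inter_mem (Metric.closedEBall_mem_nhds z (ENNReal.half_pos hε.ne')) ?_)
      exact hc.continuousAt (Filter.mem_of_superset hN subset_closure)
    · refine (Metric.ediam_mono (Set.inter_subset_right.trans Set.inter_subset_left)).trans
        (Metric.ediam_closedEBall_le.trans ?_)
      rw [ENNReal.mul_div_cancel (by simp) (by simp)]
  refine ⟨fun b => bif b then C ∩ (Metric.closedEBall x (ε / 2) ∩ h ⁻¹' closure U)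
    else C ∩ (Metric.closedEBall y (ε / 2) ∩ h ⁻¹' closure V), ?_, ?_⟩
  · rintro (_ | _)
    · exact aux y hy V hV
    · exact aux x hx U hU
  · refine hUV.symm.mono ?_ ?_ <;>
    · rintro _ ⟨z, hz, rfl⟩
      exact hz.2.2

/-- A continuous map on a Polish space with uncountable range is injective on the image of some
map from the Cantor space. -/
theorem Continuous.exists_nat_bool_comp_injective {β γ : Type*} [TopologicalSpace β]
    [PolishSpace β] [TopologicalSpace γ] [T25Space γ] {h : β → γ} (hc : Continuous h)
    (hunc : ¬(Set.range h).Countable) : ∃ g : (ℕ → Bool) → β, Function.Injective (h ∘ g) := by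
  let := TopologicalSpace.upgradeIsCompletelyMetrizable β
  obtain ⟨u, -, hu_mem, hu⟩ := exists_seq_strictAnti_tendsto' (zero_lt_one' ENNReal)
  let P := {C : Set β // IsClosed C ∧ ¬(h '' C).Countable}
  choose F hF hFdisj using fun (C : P) (n : ℕ) =>
    C.2.1.exists_splitting_of_not_countable_image hc C.2.2 (hu_mem n).1
  let DP : List Bool → P := List.rec ⟨Set.univ, isClosed_univ, by rwa [Set.image_univ]⟩
    fun a l ih => ⟨F ih l.length a, (hF ih l.length a).1, (hF ih l.length a).2.1⟩
  let D : List Bool → Set β := fun l => (DP l).1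
  have hanti : CantorScheme.ClosureAntitone D :=
    CantorScheme.Antitone.closureAntitone (fun l a => (hF (DP l) l.length a).2.2.1)
      fun l => (DP l).2.1
  have hdiam : CantorScheme.VanishingDiam D := by
    intro x
    rw [← Filter.tendsto_add_atTop_iff_nat 1]
    refine tendsto_of_tendsto_of_tendsto_of_le_of_le tendsto_const_nhds hu
      (fun _ => bot_le) fun n => ?_
    exact (hF (DP (PiNat.res x n)) (PiNat.res x n).length (x n)).2.2.2.trans_eq
      (by rw [PiNat.res_length])
  have hne : ∀ l, (D l).Nonempty := fun l => by
    by_contra hcon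
    rw [Set.not_nonempty_iff_eq_empty] at hcon
    exact (DP l).2.2 (by simp [show (DP l).1 = ∅ from hcon])
  have hdom : ∀ x : ℕ → Bool, x ∈ (CantorScheme.inducedMap D).1 := fun x => by
    rw [hanti.map_of_vanishingDiam hdiam hne]
    trivial
  refine ⟨fun x => (CantorScheme.inducedMap D).2 ⟨x, hdom x⟩, fun x y hxy => ?_⟩
  by_contra hne'
  have hres : PiNat.res x (PiNat.firstDiff x y) = PiNat.res y (PiNat.firstDiff x y) :=
    PiNat.res_eq_res.2 fun _ hm => PiNat.apply_eq_of_lt_firstDiff hm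
  have hdiff := PiNat.apply_firstDiff_ne hne'
  have hx := CantorScheme.map_mem ⟨x, hdom x⟩ (PiNat.firstDiff x y + 1)
  have hy := CantorScheme.map_mem ⟨y, hdom y⟩ (PiNat.firstDiff x y + 1)
  rw [PiNat.res_succ] at hx hy
  rw [← hres] at hy
  have hd : Disjoint (h '' D (x (PiNat.firstDiff x y) :: PiNat.res x (PiNat.firstDiff x y)))
      (h '' D (y (PiNat.firstDiff x y) :: PiNat.res x (PiNat.firstDiff x y))) := by
    generalize x (PiNat.firstDiff x y) = a at hdiff
    generalize y (PiNat.firstDiff x y) = b at hdiff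
    cases a <;> cases b <;> try contradiction
    · exact hFdisj _ _
    · exact (hFdisj _ _).symm
  exact Set.disjoint_left.1 hd ⟨_, hx, rfl⟩ ⟨_, hy, hxy.symm⟩

/-- A map on a standard Borel space all of whose preimages are measurable has countable range. -/
theorem Set.countable_range_of_forall_measurableSet_preimage {α X : Type*} [MeasurableSpace α]
    [StandardBorelSpace α] {f : α → X} (hf : ∀ A : Set X, MeasurableSet (f ⁻¹' A)) :
    (Set.range f).Countable := by
  by_contra hunc
  rcases isEmpty_or_nonempty α with hα | hα
  · exact hunc (by simp [Set.range_eq_empty])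
  let φ : X → ℝ := embeddingReal α ∘ Function.invFun f
  have hφ : Set.InjOn φ (Set.range f) := by
    rintro _ ⟨a, rfl⟩ _ ⟨b, rfl⟩ hab
    have h := (measurableEmbedding_embeddingReal α).injective hab
    rw [← Function.invFun_eq (f := f) ⟨a, rfl⟩, h, Function.invFun_eq (f := f) ⟨b, rfl⟩]
  have hg : Measurable (φ ∘ f) := fun B _ => hf (φ ⁻¹' B)
  let := upgradeStandardBorel α
  obtain ⟨t', -, hcont, hpol⟩ := hg.exists_continuous
  have hunc' : ¬(Set.range (φ ∘ f)).Countable := by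
    rw [Set.range_comp]
    exact fun h => hunc (Set.countable_of_injective_of_countable_image hφ h)
  obtain ⟨c, hc⟩ := @Continuous.exists_nat_bool_comp_injective α ℝ t' hpol _ _ _ hcont hunc'
  have hfc : Function.Injective (f ∘ c) := Function.Injective.of_comp (f := φ) hc
  have hinj : Function.Injective fun A : Set (ℕ → Bool) =>
      (⟨f ⁻¹' ((f ∘ c) '' A), hf _⟩ : {s : Set α // MeasurableSet s}) := by
    intro A A' hA
    have h : c ⁻¹' (f ⁻¹' ((f ∘ c) '' A)) = c ⁻¹' (f ⁻¹' ((f ∘ c) '' A')) :=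
      congrArg (fun s => c ⁻¹' s.1) hA
    rwa [← Set.preimage_comp, ← Set.preimage_comp, hfc.preimage_image, hfc.preimage_image] at h
  have hcard : Cardinal.mk {s : Set α // MeasurableSet s} ≤ Cardinal.continuum := by
    obtain ⟨b, hb, hgen⟩ := MeasurableSpace.CountablyGenerated.isCountablyGenerated (α := α)
    rw [hgen]
    exact MeasurableSpace.cardinal_measurableSet_le_continuum
      (hb.le_aleph0.trans Cardinal.aleph0_le_continuum)
  have hle := (Cardinal.lift_mk_le_lift_mk_of_injective hinj).trans
    (Cardinal.lift_le_continuum.2 hcard)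
  rw [Cardinal.lift_le_continuum, Cardinal.mk_set] at hle
  refine (Cardinal.cantor _).not_ge (hle.trans_eq ?_)
  simp

/-- A Borel measurable map from a standard Borel space to a metric space is strongly measurable,
whether or not the target is separable. -/
theorem stronglyMeasurable_of_measurable_of_standardBorel {α X : Type*} [MeasurableSpace α]
    [StandardBorelSpace α] [MetricSpace X] [MeasurableSpace X] [BorelSpace X] {f : α → X}
    (hf : Measurable f) : StronglyMeasurable f := by
  have hcount : ∀ (ε : NNReal) (D : Set X), 0 < ε → D ⊆ Set.range f → Metric.IsSeparated ε D →
      D.Countable := by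
    intro ε D hε hD hsep
    have hclosed : ∀ A ⊆ D, IsClosed A := fun A hA =>
      Metric.isClosed_of_pairwise_le_dist (ε := ε) hε fun x hx y hy hxy => by
        have : (ε : ENNReal) < edist x y := hsep (hA hx) (hA hy) hxy
        rw [edist_nndist] at this
        show (ε : ℝ) ≤ dist x y
        rw [← coe_nndist]
        exact_mod_cast this.le
    have hDm : MeasurableSet (f ⁻¹' D) := hf (hclosed D subset_rfl).measurableSet
    have := hDm.standardBorel
    have hr : Set.range (fun a : f ⁻¹' D => f a) = D := by
      ext x
      constructor
      · rintro ⟨a, rfl⟩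
        exact a.2
      · intro hx
        obtain ⟨a, rfl⟩ := hD hx
        exact ⟨⟨a, hx⟩, rfl⟩
    rw [← hr]
    refine Set.countable_range_of_forall_measurableSet_preimage fun A => ?_
    have : (fun a : f ⁻¹' D => f a) ⁻¹' A = Subtype.val ⁻¹' (f ⁻¹' (A ∩ D)) := by
      ext a
      exact ⟨fun ha => ⟨ha, a.2⟩, fun ha => ha.1⟩
    rw [this]
    exact measurable_subtype_coe (hf (hclosed _ Set.inter_subset_right).measurableSet)
  refine stronglyMeasurable_iff_measurable_separable.2 ⟨hf, ?_⟩
  obtain ⟨t, -, htc, ht⟩ := EMetric.subset_countable_closure_of_almost_dense_set (Set.range f) (by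
    intro ε hε
    obtain ⟨δ, hδ, hδε⟩ := ENNReal.lt_iff_exists_nnreal_btwn.1 hε
    obtain ⟨N, hN⟩ := zorn_subset {N : Set X | N ⊆ Set.range f ∧ Metric.IsSeparated δ N} (by
      intro c hc hchain
      refine ⟨⋃₀ c, ⟨Set.sUnion_subset fun s hs => (hc hs).1, ?_⟩,
        fun s hs => Set.subset_sUnion_of_mem hs⟩
      exact (Set.pairwise_sUnion hchain.directedOn).2 fun s hs => (hc hs).2)
    refine ⟨N, hcount δ N (by exact_mod_cast hδ) hN.prop.1 hN.prop.2, ?_⟩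
    refine (Metric.isCover_iff_subset_iUnion_closedEBall.1
      (Metric.IsCover.of_maximal_isSeparated hN)).trans ?_
    exact Set.iUnion₂_mono fun x _ => Metric.closedEBall_subset_closedEBall hδε.le)
  exact ⟨t, htc, ht⟩

theorem MeasureTheory.AEStronglyMeasurable.of_stronglyMeasurable_subtype {α X : Type*}
    [MeasurableSpace α] [TopologicalSpace X] {μ : Measure α} {s : Set α} (hs : MeasurableSet s)
    {f : α → X} (hf : StronglyMeasurable fun a : s => f a) :
    AEStronglyMeasurable f (μ.restrict s) := by
  rw [← map_comap_subtype_coe hs, (MeasurableEmbedding.subtype_coe hs).aestronglyMeasurable_map_iff]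
  exact hf.aestronglyMeasurable

theorem integral_const_mul_exp_le {b N t₀ t : ℝ} (hN : 0 ≤ N) :
    b * ∫ s in t₀..t, N * Real.exp (2 * b * (s - t₀)) ≤
      N / 2 * Real.exp (2 * b * (t - t₀)) := by
  have hderiv : ∀ s ∈ Set.uIcc t₀ t, HasDerivAt (fun s => N / 2 * Real.exp (2 * b * (s - t₀)))
      (b * (N * Real.exp (2 * b * (s - t₀)))) s := fun s _ => by
    refine ((((hasDerivAt_id s).sub_const t₀).const_mul (2 * b)).exp.const_mul (N / 2)).congr_deriv ?_
    simp only [id]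
    ring
  rw [← intervalIntegral.integral_const_mul, intervalIntegral.integral_eq_sub_of_hasDerivAt hderiv
    (Continuous.intervalIntegrable (by fun_prop) _ _)]
  simp only [sub_self, mul_zero, Real.exp_zero]
  linarith

/-- A Grönwall bound for a bounded function `u`, of which no measurability is required: the
integral inequality is only assumed for exponential majorants of `u`. -/
theorem le_exp_of_forall_le_integral {u : ℝ → ℝ} {t₀ T a b M : ℝ} (ha : 0 ≤ a) (hb : 0 ≤ b)
    (hu : ∀ t ∈ Set.Icc t₀ T, u t ≤ M)
    (h : ∀ N, 0 ≤ N → (∀ s ∈ Set.Icc t₀ T, u s ≤ N * Real.exp (2 * b * (s - t₀))) →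
      ∀ t ∈ Set.Icc t₀ T, u t ≤ a + b * ∫ s in t₀..t, N * Real.exp (2 * b * (s - t₀))) :
    ∀ t ∈ Set.Icc t₀ T, u t ≤ 2 * a * Real.exp (2 * b * (t - t₀)) := by
  have hexp : ∀ t ∈ Set.Icc t₀ T, 1 ≤ Real.exp (2 * b * (t - t₀)) := fun t ht =>
    Real.one_le_exp (mul_nonneg (by positivity) (sub_nonneg.2 ht.1))
  have hind : ∀ n : ℕ, ∀ t ∈ Set.Icc t₀ T,
      u t ≤ (2 * a + |M| * (1 / 2) ^ n) * Real.exp (2 * b * (t - t₀)) := by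
    intro n
    induction n with
    | zero =>
      intro t ht
      have h0 : 0 ≤ 2 * a + |M| := by positivity
      calc u t ≤ 2 * a + |M| := by linarith [hu t ht, le_abs_self M]
        _ ≤ (2 * a + |M|) * Real.exp (2 * b * (t - t₀)) := le_mul_of_one_le_right h0 (hexp t ht)
        _ = _ := by simp
    | succ n ih =>
      intro t ht
      have hN : 0 ≤ 2 * a + |M| * (1 / 2) ^ n := by positivity
      have h1 := h _ hN ih t ht
      have h2 := integral_const_mul_exp_le (b := b) (t₀ := t₀) (t := t) hN
      have h3 := le_mul_of_one_le_right ha (hexp t ht)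
      rw [pow_succ]
      linarith
  intro t ht
  have hlim : Filter.Tendsto
      (fun n : ℕ => (2 * a + |M| * (1 / 2) ^ n) * Real.exp (2 * b * (t - t₀))) Filter.atTop
      (nhds ((2 * a + |M| * 0) * Real.exp (2 * b * (t - t₀)))) :=
    ((tendsto_pow_atTop_nhds_zero_of_lt_one (by norm_num) (by norm_num)).const_mul _
      |>.const_add _).mul_const _
  simpa using ge_of_tendsto' hlim fun n => hind n t ht

section Convolution

variable {E : Type*} [NormedAddCommGroup E] [NormedSpace ℝ E] {S : ℝ → E →L[ℝ] E} {C T t₀ t : ℝ}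

theorem norm_integral_convolution_le (hC : ∀ t ∈ Set.Icc (0 : ℝ) T, ‖S t‖ ≤ C) (ht₀ : 0 ≤ t₀)
    (ht : t ∈ Set.Icc t₀ T) {G : ℝ → E} {g : ℝ → ℝ} (hg : Continuous g)
    (hGg : ∀ s ∈ Set.Icc t₀ T, ‖G s‖ ≤ g s) :
    ‖∫ s in t₀..t, S (t - s) (G s)‖ ≤ C * ∫ s in t₀..t, g s := by
  rw [← intervalIntegral.integral_const_mul]
  refine intervalIntegral.norm_integral_le_of_norm_le ht.1 (ae_of_all _ fun s hs => ?_)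
    (Continuous.intervalIntegrable (by fun_prop) _ _)
  have hS := hC (t - s) ⟨by linarith [hs.2], by linarith [hs.1, ht.2]⟩
  exact (S (t - s)).le_of_opNorm_le_of_le hS (hGg s ⟨hs.1.le, hs.2.trans ht.2⟩)

theorem intervalIntegrable_convolution [MeasurableSpace E] [BorelSpace E]
    (hS : Measurable fun p : ℝ × E => S p.1 p.2)
    (hC : ∀ t ∈ Set.Icc (0 : ℝ) T, ‖S t‖ ≤ C) (ht₀ : 0 ≤ t₀) (ht : t ∈ Set.Icc t₀ T)
    {G : ℝ → E} (hG : BddMeasOn G t₀ T) :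
    IntervalIntegrable (fun s => S (t - s) (G s)) volume t₀ t := by
  obtain ⟨hGm, M, hM⟩ := hG
  have hmeas : Measurable fun s : Set.Icc t₀ T => S (t - s) (G s) :=
    hS.comp ((measurable_const.sub measurable_subtype_coe).prodMk hGm)
  have := (measurableSet_Icc (a := t₀) (b := T)).standardBorel
  have hsm := AEStronglyMeasurable.of_stronglyMeasurable_subtype (μ := volume) measurableSet_Icc
    (f := fun s => S (t - s) (G s)) (stronglyMeasurable_of_measurable_of_standardBorel hmeas)
  rw [intervalIntegrable_iff_integrableOn_Ioc_of_le ht.1]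
  refine ⟨(hsm.mono_measure (Measure.restrict_mono (Set.Ioc_subset_Icc_self.trans
      (Set.Icc_subset_Icc_right ht.2)) le_rfl)),
    .restrict_of_bounded (C * M) (by simp) ?_⟩
  refine (ae_restrict_iff' measurableSet_Ioc).2 (ae_of_all _ fun s hs => ?_)
  have hSs := hC (t - s) ⟨by linarith [hs.2], by linarith [hs.1, ht.2]⟩
  exact (S (t - s)).le_of_opNorm_le_of_le hSs (hM s ⟨hs.1.le, hs.2.trans ht.2⟩)

theorem norm_integral_convolution_sub_le [MeasurableSpace E] [BorelSpace E]
    (hS : Measurable fun p : ℝ × E => S p.1 p.2)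
    (hC : ∀ t ∈ Set.Icc (0 : ℝ) T, ‖S t‖ ≤ C) (ht₀ : 0 ≤ t₀) (ht : t ∈ Set.Icc t₀ T)
    {G H : ℝ → E} (hG : BddMeasOn G t₀ T) (hH : BddMeasOn H t₀ T) {g : ℝ → ℝ}
    (hg : Continuous g) (hGg : ∀ s ∈ Set.Icc t₀ T, ‖G s - H s‖ ≤ g s) :
    ‖(∫ s in t₀..t, S (t - s) (G s)) - ∫ s in t₀..t, S (t - s) (H s)‖ ≤
      C * ∫ s in t₀..t, g s := by
  rw [← intervalIntegral.integral_sub (intervalIntegrable_convolution hS hC ht₀ ht hG)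
    (intervalIntegrable_convolution hS hC ht₀ ht hH)]
  simp only [← map_sub]
  exact norm_integral_convolution_le hC ht₀ ht hg hGg

end Convolution

theorem BddMeasOn.clm_apply {E : Type*} [NormedAddCommGroup E] [NormedSpace ℝ E]
    [MeasurableSpace E] [BorelSpace E] {A : ℝ → E →L[ℝ] E} {G : ℝ → E} {t₀ T : ℝ}
    (hA : BddMeasOn A t₀ T) (hG : BddMeasOn G t₀ T) : BddMeasOn (fun s => A s (G s)) t₀ T := by
  obtain ⟨hAm, M, hM⟩ := hA
  obtain ⟨hGm, N, hN⟩ := hG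
  have := (measurableSet_Icc (a := t₀) (b := T)).standardBorel
  refine ⟨?_, M * N, fun s hs => (A s).le_of_opNorm_le_of_le (hM s hs) (hN s hs)⟩
  exact (isBoundedBilinearMap_apply.continuous.comp_stronglyMeasurable
    ((stronglyMeasurable_of_measurable_of_standardBorel hAm).prodMk
      (stronglyMeasurable_of_measurable_of_standardBorel hGm))).measurable

theorem norm_sub_le_of_hasFDerivAt {E F : Type*} [NormedAddCommGroup E] [NormedSpace ℝ E]
    [NormedAddCommGroup F] [NormedSpace ℝ F] {f : E → F} {f' : E → E →L[ℝ] F} {K : ℝ}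
    (hf : ∀ x, HasFDerivAt f (f' x) x) (hK : ∀ x, ‖f' x‖ ≤ K) (x y : E) :
    ‖f x - f y‖ ≤ K * ‖x - y‖ :=
  convex_univ.norm_image_sub_le_of_norm_hasFDerivWithin_le
    (fun z _ => (hf z).hasFDerivWithinAt) (fun z _ => hK z) (Set.mem_univ y) (Set.mem_univ x)

section Estimates

variable {E : Type u} [NormedAddCommGroup E] [NormedSpace ℝ E] {S : ℝ → E →L[ℝ] E}
  {C_A K_B M_B T t₀ : ℝ}

theorem exp_two_mul_sub_le {b t : ℝ} (hb : 0 ≤ b) (ht₀ : 0 ≤ t₀) (ht : t ∈ Set.Icc t₀ T) :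
    Real.exp (2 * b * (t - t₀)) ≤ Real.exp (2 * b * T) := by
  gcongr
  linarith [ht.2]

theorem IsMildSolution.norm_sub_le [MeasurableSpace E] [BorelSpace E]
    (hS : Measurable fun p : ℝ × E => S p.1 p.2) (hC : ∀ t ∈ Set.Icc (0 : ℝ) T, ‖S t‖ ≤ C_A)
    (ht₀ : 0 ≤ t₀) (hC0 : 0 ≤ C_A) (hK0 : 0 ≤ K_B) {B : ℝ → E → E} {Bsup : ℝ}
    (hB : Measurable (Function.uncurry B)) (hBsup : ∀ t x, ‖B t x‖ ≤ Bsup)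
    (hlip : ∀ t x y, ‖B t x - B t y‖ ≤ K_B * ‖x - y‖) {z Y₁ Y₂ : ℝ → E} {y₁ y₂ : E}
    (hY₁ : IsMildSolution S B t₀ T y₁ z Y₁) (hY₂ : IsMildSolution S B t₀ T y₂ z Y₂)
    (hb₁ : BddMeasOn Y₁ t₀ T) (hb₂ : BddMeasOn Y₂ t₀ T) {t : ℝ} (ht : t ∈ Set.Icc t₀ T) :
    ‖Y₁ t - Y₂ t‖ ≤ 2 * (C_A * ‖y₁ - y₂‖) * Real.exp (2 * (C_A * K_B) * T) := by
  have hBY : ∀ Y : ℝ → E, BddMeasOn Y t₀ T → BddMeasOn (fun s => B s (Y s)) t₀ T := fun Y hY =>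
    ⟨hB.comp (measurable_subtype_coe.prodMk hY.1), Bsup, fun s _ => hBsup _ _⟩
  obtain ⟨M₁, hM₁⟩ := hb₁.2
  obtain ⟨M₂, hM₂⟩ := hb₂.2
  refine (le_exp_of_forall_le_integral (u := fun t => ‖Y₁ t - Y₂ t‖) (M := M₁ + M₂)
    (by positivity) (mul_nonneg hC0 hK0)
    (fun s hs => norm_sub_le_of_le (hM₁ s hs) (hM₂ s hs)) ?_ t ht).trans
    (mul_le_mul_of_nonneg_left (exp_two_mul_sub_le (mul_nonneg hC0 hK0) ht₀ ht) (by positivity))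
  intro N hN hle t ht
  have hint := norm_integral_convolution_sub_le hS hC ht₀ ht (hBY Y₁ hb₁) (hBY Y₂ hb₂)
    (g := fun s => K_B * (N * Real.exp (2 * (C_A * K_B) * (s - t₀)))) (by fun_prop)
    fun s hs => (hlip s _ _).trans (mul_le_mul_of_nonneg_left (hle s hs) hK0)
  rw [intervalIntegral.integral_const_mul, ← mul_assoc] at hint
  have hSt := (S (t - t₀)).le_of_opNorm_le
    (hC _ ⟨by linarith [ht.1], by linarith [ht.2]⟩) (y₁ - y₂)
  have heq : Y₁ t - Y₂ t = S (t - t₀) (y₁ - y₂) +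
      ((∫ s in t₀..t, S (t - s) (B s (Y₁ s))) - ∫ s in t₀..t, S (t - s) (B s (Y₂ s))) := by
    rw [hY₁ t ht, hY₂ t ht, map_sub]
    abel
  simp only [heq]
  exact norm_add_le_of_le hSt hint

theorem IsFirstVariation.norm_apply_le (hC : ∀ t ∈ Set.Icc (0 : ℝ) T, ‖S t‖ ≤ C_A)
    (ht₀ : 0 ≤ t₀) (hC0 : 0 ≤ C_A) (hK0 : 0 ≤ K_B) {DB : ℝ → E → E →L[ℝ] E}
    (hDB : ∀ t x, ‖DB t x‖ ≤ K_B) {Y : ℝ → E} {ξ : ℝ → E →L[ℝ] E}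
    (hξ : IsFirstVariation S DB t₀ T Y ξ) {M : ℝ} (hM : ∀ t ∈ Set.Icc t₀ T, ‖ξ t‖ ≤ M) (h : E)
    {t : ℝ} (ht : t ∈ Set.Icc t₀ T) :
    ‖ξ t h‖ ≤ 2 * (C_A * ‖h‖) * Real.exp (2 * (C_A * K_B) * T) := by
  refine (le_exp_of_forall_le_integral (u := fun t => ‖ξ t h‖) (M := M * ‖h‖)
    (by positivity) (mul_nonneg hC0 hK0) (fun s hs => (ξ s).le_of_opNorm_le (hM s hs) h)
    ?_ t ht).trans
    (mul_le_mul_of_nonneg_left (exp_two_mul_sub_le (mul_nonneg hC0 hK0) ht₀ ht) (by positivity))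
  intro N hN hle t ht
  have hint := norm_integral_convolution_le hC ht₀ ht (G := fun s => DB s (Y s) (ξ s h))
    (g := fun s => K_B * (N * Real.exp (2 * (C_A * K_B) * (s - t₀)))) (by fun_prop)
    fun s hs => (DB s (Y s)).le_of_opNorm_le_of_le (hDB _ _) (hle s hs)
  rw [intervalIntegral.integral_const_mul, ← mul_assoc] at hint
  have hSt := (S (t - t₀)).le_of_opNorm_le
    (hC _ ⟨by linarith [ht.1], by linarith [ht.2]⟩) h
  simp only [hξ t ht h]
  exact norm_add_le_of_le hSt hint

theorem IsFirstVariation.norm_apply_sub_le [MeasurableSpace E] [BorelSpace E]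
    (hS : Measurable fun p : ℝ × E => S p.1 p.2) (hC : ∀ t ∈ Set.Icc (0 : ℝ) T, ‖S t‖ ≤ C_A)
    (ht₀ : 0 ≤ t₀) (hC0 : 0 ≤ C_A) (hK0 : 0 ≤ K_B) {DB : ℝ → E → E →L[ℝ] E}
    (hDBm : Measurable fun p : ℝ × E => DB p.1 p.2) (hDB : ∀ t x, ‖DB t x‖ ≤ K_B)
    {Y₁ Y₂ : ℝ → E} (hY₁ : BddMeasOn Y₁ t₀ T) (hY₂ : BddMeasOn Y₂ t₀ T)
    {ξ₁ ξ₂ : ℝ → E →L[ℝ] E} (hξ₁ : IsFirstVariation S DB t₀ T Y₁ ξ₁)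
    (hξ₂ : IsFirstVariation S DB t₀ T Y₂ ξ₂) (hb₁ : BddMeasOn ξ₁ t₀ T)
    (hb₂ : BddMeasOn ξ₂ t₀ T) {h : E} {d : ℝ} (hd0 : 0 ≤ d)
    (hd : ∀ s ∈ Set.Icc t₀ T, ‖(DB s (Y₁ s) - DB s (Y₂ s)) (ξ₁ s h)‖ ≤ d)
    {t : ℝ} (ht : t ∈ Set.Icc t₀ T) :
    ‖ξ₁ t h - ξ₂ t h‖ ≤ 2 * (C_A * (T * d)) * Real.exp (2 * (C_A * K_B) * T) := by
  have hT : 0 ≤ T := ht₀.trans (ht.1.trans ht.2)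
  have hconst : BddMeasOn (fun _ => h) t₀ T := ⟨measurable_const, ‖h‖, fun _ _ => le_rfl⟩
  have hG : ∀ (Y : ℝ → E) (ξ : ℝ → E →L[ℝ] E), BddMeasOn Y t₀ T → BddMeasOn ξ t₀ T →
      BddMeasOn (fun s => DB s (Y s) (ξ s h)) t₀ T := fun Y ξ hY hξ =>
    BddMeasOn.clm_apply (A := fun s => DB s (Y s))
      ⟨hDBm.comp (measurable_subtype_coe.prodMk hY.1), K_B, fun s _ => hDB _ _⟩
      (hξ.clm_apply hconst)
  obtain ⟨M₁, hM₁⟩ := (hb₁.clm_apply hconst).2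
  obtain ⟨M₂, hM₂⟩ := (hb₂.clm_apply hconst).2
  refine (le_exp_of_forall_le_integral (u := fun t => ‖ξ₁ t h - ξ₂ t h‖) (M := M₁ + M₂)
    (by positivity) (mul_nonneg hC0 hK0)
    (fun s hs => norm_sub_le_of_le (hM₁ s hs) (hM₂ s hs)) ?_ t ht).trans
    (mul_le_mul_of_nonneg_left (exp_two_mul_sub_le (mul_nonneg hC0 hK0) ht₀ ht) (by positivity))
  intro N hN hle t ht
  have hint := norm_integral_convolution_sub_le hS hC ht₀ ht (hG Y₁ ξ₁ hY₁ hb₁) (hG Y₂ ξ₂ hY₂ hb₂)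
    (g := fun s => d + K_B * (N * Real.exp (2 * (C_A * K_B) * (s - t₀)))) (by fun_prop)
    fun s hs => by
      have heq : DB s (Y₁ s) (ξ₁ s h) - DB s (Y₂ s) (ξ₂ s h) =
          (DB s (Y₁ s) - DB s (Y₂ s)) (ξ₁ s h) + DB s (Y₂ s) (ξ₁ s h - ξ₂ s h) := by
        simp
      rw [heq]
      exact norm_add_le_of_le (hd s hs)
        ((DB s (Y₂ s)).le_of_opNorm_le_of_le (hDB _ _) (hle s hs))
  rw [intervalIntegral.integral_add (Continuous.intervalIntegrable (by fun_prop) _ _)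
    (Continuous.intervalIntegrable (by fun_prop) _ _), intervalIntegral.integral_const,
    intervalIntegral.integral_const_mul, mul_add, ← mul_assoc C_A K_B, smul_eq_mul] at hint
  simp only [hξ₁ t ht h, hξ₂ t ht h, add_sub_add_left_eq_sub]
  refine hint.trans (add_le_add_left ?_ _)
  gcongr
  linarith [ht.2]

end Estimates

/-- There is a constant `C̃_ξ` depending only on `C_A`, `K_B`, `M_B`
and `T` with `‖ξ^{t₀,y+k}(t)h − ξ^{t₀,y}(t)h‖ ≤ C̃_ξ ‖h‖ ‖k‖`: the first variation
`y ↦ ξ^{t₀,y}(t)` is Lipschitz from `E` to `L(E,E)`, uniformly in `t`. -/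
theorem first_variation_lipschitz_in_initial_datum (C_A K_B M_B T : ℝ) :
    ∃ Cξ : ℝ, ∀ (E : Type u) [NormedAddCommGroup E] [NormedSpace ℝ E] [CompleteSpace E]
      [MeasurableSpace E] [BorelSpace E],
      ∀ (t₀ : ℝ), 0 < T → t₀ ∈ Set.Ico (0:ℝ) T →
      ∀ S : ℝ → E →L[ℝ] E,
        S 0 = ContinuousLinearMap.id ℝ E →
        (∀ s t : ℝ, 0 ≤ s → 0 ≤ t → s + t ≤ T → (S t).comp (S s) = S (s + t)) →
        (∀ t ∈ Set.Icc (0:ℝ) T, ‖S t‖ ≤ C_A) →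
        (Measurable fun p : ℝ × E => S p.1 p.2) →
      ∀ (B : ℝ → E → E) (DB : ℝ → E → E →L[ℝ] E)
        (D2B : ℝ → E → E →L[ℝ] E →L[ℝ] E) (Bsup : ℝ),
        Measurable (Function.uncurry B) →
        (Measurable fun p : ℝ × E => DB p.1 p.2) →
        (Measurable fun p : ℝ × E => D2B p.1 p.2) →
        (∀ t x, ‖B t x‖ ≤ Bsup) →
        (∀ t x, HasFDerivAt (B t) (DB t x) x) →
        (∀ t x, ‖DB t x‖ ≤ K_B) →
        (∀ t x, HasFDerivAt (fun w => DB t w) (D2B t x) x) →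
        (∀ t x, ‖D2B t x‖ ≤ M_B) →
      ∀ z : ℝ → E, BddMeasOn z t₀ T →
      ∀ (Y : E → ℝ → E) (ξ : E → ℝ → E →L[ℝ] E),
        (∀ y : E, BddMeasOn (Y y) t₀ T ∧ IsMildSolution S B t₀ T y z (Y y)) →
        (∀ y : E, BddMeasOn (ξ y) t₀ T ∧ IsFirstVariation S DB t₀ T (Y y) (ξ y)) →
        ∀ (y k h : E), ∀ t ∈ Set.Icc t₀ T,
          ‖ξ (y + k) t h - ξ y t h‖ ≤ Cξ * ‖h‖ * ‖k‖ := by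
  refine ⟨2 * (C_A * (T * (M_B * (2 * C_A * Real.exp (2 * (C_A * K_B) * T)) *
    (2 * C_A * Real.exp (2 * (C_A * K_B) * T))))) * Real.exp (2 * (C_A * K_B) * T), ?_⟩
  intro E _ _ _ _ _ t₀ hT ht₀ S _ _ hC hS B DB D2B Bsup hB hDBm _ hBsup hDB hK hD2B hM z _ Y ξ
    hY hξ y k h t ht
  have hC0 : 0 ≤ C_A := (norm_nonneg _).trans (hC 0 ⟨le_rfl, hT.le⟩)
  have hK0 : 0 ≤ K_B := (norm_nonneg _).trans (hK 0 0)
  have hM0 : 0 ≤ M_B := (norm_nonneg (D2B 0 0)).trans (hM 0 0)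
  set e := Real.exp (2 * (C_A * K_B) * T)
  obtain ⟨M, hξM⟩ := (hξ (y + k)).1.2
  have hYk : ∀ s ∈ Set.Icc t₀ T, ‖Y (y + k) s - Y y s‖ ≤ 2 * (C_A * ‖k‖) * e := fun s hs => by
    simpa using (hY (y + k)).2.norm_sub_le hS hC ht₀.1 hC0 hK0 hB hBsup
      (fun t => norm_sub_le_of_hasFDerivAt (hDB t) (hK t)) (hY y).2 (hY (y + k)).1 (hY y).1 hs
  have hmain := (hξ (y + k)).2.norm_apply_sub_le (h := h)
    (d := M_B * (2 * (C_A * ‖k‖) * e) * (2 * (C_A * ‖h‖) * e)) hS hC ht₀.1 hC0 hK0 hDBm hK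
    (hY (y + k)).1 (hY y).1 (hξ y).2 (hξ (y + k)).1 (hξ y).1 (by positivity)
    (fun s hs => ContinuousLinearMap.le_of_opNorm_le_of_le _
      ((norm_sub_le_of_hasFDerivAt (hD2B s) (hM s) _ _).trans
        (mul_le_mul_of_nonneg_left (hYk s hs) hM0))
      ((hξ (y + k)).2.norm_apply_le hC ht₀.1 hC0 hK0 hK hξM h hs)) ht
  exact hmain.trans_eq (by ring)
end

section
/- There exists a unique bounded measurable map η^{t₀,y} : [t₀,T] → L(E,E;E) (bounded bilinear maps E × E → E) satisfying, for all t ∈ [t₀,T] and h,k ∈ E, η(t)(h,k) = ∫_{t₀}^t S(t−s) D²B(s,Y^{t₀,y}(s))(ξ^{t₀,y}(s)h, ξ^{t₀,y}(s)k) ds + ∫_{t₀}^t S(t−s) DB(s,Y^{t₀,y}(s))(η(s)(h,k)) ds; moreover there is a constant C_η, depending only on C_A, K_B, M_B and T, with ‖η^{t₀,y}(t)‖_{L(E,E;E)} ≤ C_η for all t. -/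
open MeasureTheory

/-- `η` solves the second variation equation along `Y, ξ` on `[t₀,T]`:
`η(t)(h,k) = ∫ S(t-s) D²B(s,Y(s))(ξ(s)h, ξ(s)k) ds + ∫ S(t-s) DB(s,Y(s))(η(s)(h,k)) ds`. -/
def IsSecondVariation {E : Type u} [NormedAddCommGroup E] [NormedSpace ℝ E]
    (S : ℝ → E →L[ℝ] E) (DB : ℝ → E → E →L[ℝ] E)
    (D2B : ℝ → E → E →L[ℝ] E →L[ℝ] E) (t₀ T : ℝ)
    (Y : ℝ → E) (ξ : ℝ → E →L[ℝ] E) (η : ℝ → E →L[ℝ] E →L[ℝ] E) : Prop :=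
  ∀ t ∈ Set.Icc t₀ T, ∀ h k : E,
    η t h k = (∫ s in t₀..t, S (t - s) (D2B s (Y s) (ξ s h) (ξ s k)))
      + ∫ s in t₀..t, S (t - s) (DB s (Y s) (η s h k))

open Cardinal in
/-- A standard Borel space all of whose subsets are measurable is countable. -/
theorem countable_of_forall_measurableSet {A : Type*} [MeasurableSpace A] [StandardBorelSpace A]
    (h : ∀ s : Set A, MeasurableSet s) : Countable A := by
  by_contra hA
  have e : A ≃ᵐ ℝ := PolishSpace.measurableEquivOfNotCountable hA
    (by simp)
  have hR : ∀ s : Set ℝ, MeasurableSet s := fun s => by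
    have := e.measurableSet_preimage.1 (h (e ⁻¹' s))
    exact this
  obtain ⟨b, hb, hb'⟩ := MeasurableSpace.CountablyGenerated.isCountablyGenerated (α := ℝ)
  have h1 : #{t : Set ℝ | @MeasurableSet ℝ (MeasurableSpace.generateFrom b) t} ≤ 𝔠 :=
    MeasurableSpace.cardinal_measurableSet_le_continuum
      ((Cardinal.le_aleph0_iff_set_countable.2 hb).trans Cardinal.aleph0_le_continuum)
  have h2 : {t : Set ℝ | @MeasurableSet ℝ (MeasurableSpace.generateFrom b) t} = Set.univ := by
    ext t
    rw [← hb']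
    simpa using hR t
  rw [h2, Cardinal.mk_univ, Cardinal.mk_set, Cardinal.mk_real] at h1
  exact absurd h1 (not_le.2 (Cardinal.cantor _))

/-- A subset of the range of a Borel map on a standard Borel space is countable as soon as all
its subsets are measurable. -/
theorem Measurable.countable_of_forall_subset {X Y : Type*} [MeasurableSpace X]
    [StandardBorelSpace X] [MeasurableSpace Y] {f : X → Y} (hf : Measurable f) {D : Set Y}
    (hDf : D ⊆ Set.range f) (hD : ∀ s ⊆ D, MeasurableSet s) : D.Countable := by
  choose g hg using fun d : D => hDf d.2
  let := upgradeStandardBorel X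
  have hX' : MeasurableSet (f ⁻¹' D) := hf (hD D subset_rfl)
  have hr : Measurable fun x : f ⁻¹' D => g ⟨f x, x.2⟩ := by
    intro s _
    have : (fun x : f ⁻¹' D => g ⟨f x, x.2⟩) ⁻¹' s
        = Subtype.val ⁻¹' (f ⁻¹' (Subtype.val '' (g ⁻¹' s))) := by
      ext ⟨x, hx⟩
      have hx' : f x ∈ D := hx
      simp [hx']
    rw [this]
    exact measurable_subtype_coe (hf (hD _ (by simp)))
  have hA : MeasurableSet (Set.range g) := by
    have : Set.range g = Subtype.val '' {x : f ⁻¹' D | g ⟨f x, x.2⟩ = x} := by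
      ext x
      constructor
      · rintro ⟨d, rfl⟩
        exact ⟨⟨g d, by simp [hg]⟩, by simp [hg], rfl⟩
      · rintro ⟨x, hx, rfl⟩
        exact ⟨_, hx⟩
    rw [this]
    exact hX'.subtype_image (measurableSet_eq_fun hr measurable_subtype_coe)
  have := hA.standardBorel
  have hc : Countable (Set.range g) := countable_of_forall_measurableSet fun s => by
    have : s = Subtype.val ⁻¹' (f ⁻¹' (Subtype.val '' {d : D | ∃ x ∈ s, (x : X) = g d})) := by
      ext ⟨x, d, rfl⟩
      simp only [Set.mem_preimage, Set.mem_image, Set.mem_ofPred_eq, hg]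
      constructor
      · exact fun h => ⟨d, ⟨_, h, rfl⟩, rfl⟩
      · rintro ⟨d', ⟨x, hx, hxd⟩, hd⟩
        obtain rfl := Subtype.ext hd
        convert hx
        exact Subtype.ext hxd.symm
    rw [this]
    exact measurable_subtype_coe (hf (hD _ (by simp)))
  have : D = f '' Set.range g := by
    ext y
    constructor
    · exact fun hy => ⟨_, ⟨⟨y, hy⟩, rfl⟩, hg _⟩
    · rintro ⟨_, ⟨d, rfl⟩, rfl⟩
      simp [hg]
  rw [this]
  exact (Set.countable_coe_iff.1 hc).image f

/-- A Borel map from a standard Borel space to a metric space has separable range, hence is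
strongly measurable. -/
theorem Measurable.stronglyMeasurable_of_standardBorel {X Y : Type*} [MeasurableSpace X]
    [StandardBorelSpace X] [MetricSpace Y] [MeasurableSpace Y] [BorelSpace Y] {f : X → Y}
    (hf : Measurable f) : StronglyMeasurable f := by
  refine stronglyMeasurable_iff_measurable_separable.2 ⟨hf, ?_⟩
  obtain ⟨t, -, ht, hst⟩ := EMetric.subset_countable_closure_of_almost_dense_set (Set.range f)
    fun ε hε => by
      obtain ⟨δ, hδ, hδε⟩ := ENNReal.lt_iff_exists_nnreal_btwn.1 hε
      obtain ⟨N, hN⟩ := zorn_subset {N : Set Y | N ⊆ Set.range f ∧ Metric.IsSeparated δ N}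
        fun c hc hcc => ⟨⋃₀ c, ⟨Set.sUnion_subset fun s hs => (hc hs).1,
          (Set.pairwise_sUnion hcc.directedOn).2 fun s hs => (hc hs).2⟩,
          fun s hs => Set.subset_sUnion_of_mem hs⟩
      have hcov := Metric.IsCover.of_maximal_isSeparated hN
      refine ⟨N, hf.countable_of_forall_subset hN.prop.1 fun s hs => ?_, ?_⟩
      · refine IsClosed.measurableSet ?_
        refine Metric.isClosed_of_pairwise_le_dist (ε := δ) (by exact_mod_cast hδ) ?_
        intro x hx y hy hxy
        have : (δ : ENNReal) < EDist.edist x y := hN.prop.2 (hs hx) (hs hy) hxy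
        rw [edist_nndist] at this
        exact_mod_cast this.le
      · refine (Metric.isCover_iff_subset_iUnion_closedEBall.1 hcov).trans ?_
        exact Set.iUnion₂_mono fun x _ => Metric.closedEBall_subset_closedEBall hδε.le
  exact ⟨t, ht, hst⟩

open scoped Topology

/-- Translations act continuously in `L¹`. -/
theorem MeasureTheory.Integrable.tendsto_integral_norm_translate_sub {F : Type*}
    [NormedAddCommGroup F] {G : ℝ → F} (hG : Integrable G) :
    Filter.Tendsto (fun c => ∫ s, ‖G (c + s) - G s‖) (𝓝 0) (𝓝 0) := by
  have hm := memLp_one_iff_integrable.2 hG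
  have : Fact ((1 : ENNReal) ≠ ⊤) := ⟨ENNReal.one_ne_top⟩
  have hcont : Continuous fun c : ℝ => DomAddAct.mk c +ᵥ hm.toLp G :=
    DomAddAct.continuous_mk.vadd continuous_const
  have hlim : Filter.Tendsto (fun c : ℝ => ‖(DomAddAct.mk c +ᵥ hm.toLp G) - hm.toLp G‖)
      (𝓝 0) (𝓝 0) :=
    (hcont.sub continuous_const).norm.tendsto' _ _ (by simp)
  refine hlim.congr fun c => ?_
  rw [DomAddAct.mk_vadd_toLp, ← MemLp.toLp_sub, L1.norm_eq_integral_norm]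
  refine integral_congr_ae ?_
  filter_upwards [((hm.comp_measurePreserving (measurePreserving_vadd c volume)).sub hm).coeFn_toLp]
    with s hs
  exact congrArg (fun x : F => ‖x‖) hs

section Convolution

set_option maxSynthPendingDepth 3

theorem MeasureTheory.Integrable.apply_apply {E : Type*} [NormedAddCommGroup E]
    [NormedSpace ℝ E] {G : ℝ → E →L[ℝ] E →L[ℝ] E} (hG : Integrable G)
    (h k : E) : Integrable fun s => G s h k :=
  (hG.apply_continuousLinearMap h).apply_continuousLinearMap k

variable {E : Type*} [NormedAddCommGroup E] [NormedSpace ℝ E] [MeasurableSpace E] [BorelSpace E]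
  {P : ℝ → E →L[ℝ] E} {C : ℝ}

theorem stronglyMeasurable_kernel_apply (hP : Measurable fun p : ℝ × E => P p.1 p.2)
    {r : ℝ → ℝ} (hr : Measurable r) {v : ℝ → E} (hv : StronglyMeasurable v) :
    StronglyMeasurable fun s => P (r s) (v s) :=
  (hP.comp (hr.prodMk hv.measurable)).stronglyMeasurable_of_standardBorel

theorem integrable_kernel_apply (hP : Measurable fun p : ℝ × E => P p.1 p.2)
    (hC : ∀ u, ‖P u‖ ≤ C) {r : ℝ → ℝ} (hr : Measurable r) {v : ℝ → E}
    (hv : StronglyMeasurable v) (hvi : Integrable v) :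
    Integrable fun s => P (r s) (v s) :=
  (hvi.norm.const_mul C).mono'
    (stronglyMeasurable_kernel_apply hP hr hv).aestronglyMeasurable
    (.of_forall fun s => (P (r s)).le_of_opNorm_le (hC _) _)

/-- The strong convolution of a bounded, strongly measurable operator kernel with an integrable
function with values in bounded bilinear maps is norm continuous. -/
theorem exists_continuous_strong_convolution (hP : Measurable fun p : ℝ × E => P p.1 p.2)
    (hC : ∀ u, ‖P u‖ ≤ C) {G : ℝ → E →L[ℝ] E →L[ℝ] E} (hG : StronglyMeasurable G)
    (hGi : Integrable G) :
    ∃ J : ℝ → E →L[ℝ] E →L[ℝ] E, Continuous J ∧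
      ∀ t h k, J t h k = ∫ s, P (t - s) (G s h k) := by
  have hC0 : 0 ≤ C := (norm_nonneg _).trans (hC 0)
  have hsm : ∀ h k, StronglyMeasurable fun s => G s h k := fun h k =>
    _root_.StronglyMeasurable.apply_continuousLinearMap
      (_root_.StronglyMeasurable.apply_continuousLinearMap hG h) k
  have hint : ∀ t h k, Integrable fun s => P (t - s) (G s h k) := fun t h k =>
    integrable_kernel_apply hP hC (measurable_const.sub measurable_id) (hsm h k)
      (hGi.apply_apply h k)
  have hle : ∀ u (A : E →L[ℝ] E →L[ℝ] E) h k, ‖P u (A h k)‖ ≤ ‖A‖ * (C * ‖h‖ * ‖k‖) :=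
    fun u A h k => ((P u).le_of_opNorm_le (hC u) _).trans <| by
      calc C * ‖A h k‖ ≤ C * (‖A‖ * ‖h‖ * ‖k‖) := by gcongr; exact A.le_opNorm₂ h k
        _ = _ := by ring
  let J : ℝ → E →L[ℝ] E →L[ℝ] E := fun t =>
    LinearMap.mkContinuous₂
      (LinearMap.mk₂ ℝ (fun h k => ∫ s, P (t - s) (G s h k))
        (fun h h' k => by simp [integral_add, hint])
        (fun c h k => by simp [integral_smul])
        (fun h k k' => by simp [integral_add, hint])
        (fun c h k => by simp [integral_smul]))
      ((∫ s, ‖G s‖) * C) fun h k => by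
        refine (norm_integral_le_of_norm_le (hGi.norm.mul_const (C * ‖h‖ * ‖k‖))
          (.of_forall fun s => hle _ _ _ _)).trans_eq ?_
        rw [integral_mul_const]
        ring
  have hJ : ∀ t h k, J t h k = ∫ s, P (t - s) (G s h k) := fun _ _ _ => rfl
  refine ⟨J, ?_, hJ⟩
  have hJ' : ∀ t h k, J t h k = ∫ u, P u (G (t - u) h k) := fun t h k => by
    rw [hJ, ← integral_sub_left_eq_self _ _ t]
    simp
  have hint' : ∀ t h k, Integrable fun u => P u (G (t - u) h k) := fun t h k => by
    simpa using (hint t h k).comp_sub_left t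
  have hdiff : ∀ t t', ‖J t - J t'‖ ≤ C * ∫ s, ‖G ((t - t') + s) - G s‖ := fun t t' => by
    refine ContinuousLinearMap.opNorm_le_bound₂ _
      (mul_nonneg hC0 (integral_nonneg fun _ => norm_nonneg _)) fun h k => ?_
    have hGd : Integrable fun u => G (t - u) - G (t' - u) :=
      (hGi.comp_sub_left t).sub (hGi.comp_sub_left t')
    calc ‖(J t - J t') h k‖ = ‖∫ u, P u ((G (t - u) - G (t' - u)) h k)‖ := by
          simp [hJ', integral_sub (hint' t h k) (hint' t' h k)]
      _ ≤ ∫ u, ‖G (t - u) - G (t' - u)‖ * (C * ‖h‖ * ‖k‖) :=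
          norm_integral_le_of_norm_le (hGd.norm.mul_const _) (.of_forall fun u => hle _ _ _ _)
      _ = _ := by
          rw [integral_mul_const,
            ← integral_sub_left_eq_self (fun s => ‖G ((t - t') + s) - G s‖) _ t']
          simp only [sub_add_sub_cancel]
          ring
  refine continuous_iff_continuousAt.2 fun t' => ?_
  rw [ContinuousAt, tendsto_iff_norm_sub_tendsto_zero]
  refine squeeze_zero (fun _ => norm_nonneg _) (fun t => hdiff t t') ?_
  have h0 : Filter.Tendsto (fun t => t - t') (𝓝 t') (𝓝 0) :=
    Continuous.tendsto' (by fun_prop) _ _ (sub_self _)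
  simpa using (hGi.tendsto_integral_norm_translate_sub.comp h0).const_mul C

end Convolution

section Volterra

set_option maxSynthPendingDepth 3

open Set

theorem mul_integral_mul_exp_le {L m t₀ t : ℝ} (hL : 0 ≤ L) (hm : 0 ≤ m) :
    L * ∫ s in t₀..t, m * Real.exp ((2 * L + 1) * (s - t₀))
      ≤ m / 2 * Real.exp ((2 * L + 1) * (t - t₀)) := by
  have hL' : 0 < 2 * L + 1 := by linarith
  have hd : ∀ s, HasDerivAt (fun s => m / (2 * L + 1) * Real.exp ((2 * L + 1) * (s - t₀)))
      (m * Real.exp ((2 * L + 1) * (s - t₀))) s := fun s => by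
    have := ((((hasDerivAt_id s).sub_const t₀).const_mul (2 * L + 1)).exp).const_mul
      (m / (2 * L + 1))
    refine this.congr_deriv ?_
    simp only [id]
    field_simp
  rw [intervalIntegral.integral_eq_sub_of_hasDerivAt (fun s _ => hd s)
    (by apply Continuous.intervalIntegrable; fun_prop)]
  have he := Real.exp_pos ((2 * L + 1) * (t - t₀))
  have h1 : L * (m / (2 * L + 1)) ≤ m / 2 := by
    rw [mul_div_assoc', div_le_div_iff₀ hL' two_pos]
    nlinarith
  have h2 : 0 ≤ L * (m / (2 * L + 1)) := by positivity
  simp only [sub_self, mul_zero, Real.exp_zero, mul_one]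
  nlinarith

/-- A Grönwall inequality which requires no regularity of the bounded function `u`: the integral
inequality is only tested against continuous majorants of `u`. -/
theorem le_exp_of_le_integral_majorant {u : ℝ → ℝ} {A L M t₀ T : ℝ} (hA : 0 ≤ A) (hL : 0 ≤ L)
    (hM : ∀ s ∈ Icc t₀ T, u s ≤ M)
    (h : ∀ g : ℝ → ℝ, Continuous g → (∀ s ∈ Icc t₀ T, u s ≤ g s) →
      ∀ t ∈ Icc t₀ T, u t ≤ A + L * ∫ s in t₀..t, g s) :
    ∀ t ∈ Icc t₀ T, u t ≤ 2 * A * Real.exp ((2 * L + 1) * (t - t₀)) := by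
  have hexp : ∀ t ∈ Icc t₀ T, 1 ≤ Real.exp ((2 * L + 1) * (t - t₀)) := fun t ht =>
    Real.one_le_exp (mul_nonneg (by linarith) (sub_nonneg.2 ht.1))
  have key : ∀ n : ℕ, ∀ t ∈ Icc t₀ T,
      u t ≤ (2 * A + |M| / 2 ^ n) * Real.exp ((2 * L + 1) * (t - t₀)) := by
    intro n
    induction n with
    | zero =>
      intro t ht
      have := hexp t ht
      have := (hM t ht).trans (le_abs_self M)
      simp only [pow_zero, div_one]
      nlinarith [abs_nonneg M]
    | succ n ih =>
      intro t ht
      have h1 := h _ (by fun_prop) ih t ht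
      have h2 := mul_integral_mul_exp_le (t₀ := t₀) (t := t) hL
        (m := 2 * A + |M| / 2 ^ n) (by positivity)
      have h3 := hexp t ht
      calc u t ≤ A + (2 * A + |M| / 2 ^ n) / 2 * Real.exp ((2 * L + 1) * (t - t₀)) := by linarith
        _ ≤ A * Real.exp ((2 * L + 1) * (t - t₀))
            + (2 * A + |M| / 2 ^ n) / 2 * Real.exp ((2 * L + 1) * (t - t₀)) := by nlinarith
        _ = _ := by rw [pow_succ]; ring
  intro t ht
  have hlim : Filter.Tendsto
      (fun n : ℕ => (2 * A + |M| / 2 ^ n) * Real.exp ((2 * L + 1) * (t - t₀))) Filter.atTop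
      (𝓝 ((2 * A + 0) * Real.exp ((2 * L + 1) * (t - t₀)))) := by
    refine (tendsto_const_nhds.add ?_).mul_const _
    exact tendsto_const_nhds.div_atTop (tendsto_pow_atTop_atTop_of_one_lt one_lt_two)
  rw [add_zero] at hlim
  exact ge_of_tendsto' hlim fun n => key n t ht

variable {E : Type*} [NormedAddCommGroup E] [NormedSpace ℝ E]

theorem stronglyMeasurable_compL_comp {D : ℝ → E →L[ℝ] E} {a : ℝ → E →L[ℝ] E →L[ℝ] E}
    (hD : StronglyMeasurable D) (ha : StronglyMeasurable a) :
    StronglyMeasurable fun s => (ContinuousLinearMap.compL ℝ E E E (D s)).comp (a s) := by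
  have hc : Continuous fun p : (E →L[ℝ] E) × (E →L[ℝ] E →L[ℝ] E) =>
      (ContinuousLinearMap.compL ℝ E E E p.1).comp p.2 := by fun_prop
  exact hc.comp_stronglyMeasurable (hD.prodMk ha)

theorem MeasureTheory.StronglyMeasurable.integrable_indicator_Icc {F : Type*}
    [NormedAddCommGroup F] {f : ℝ → F} {a b M : ℝ} (hf : StronglyMeasurable f)
    (hM : ∀ s ∈ Icc a b, ‖f s‖ ≤ M) : Integrable ((Icc a b).indicator f) := by
  rw [integrable_indicator_iff measurableSet_Icc]
  exact Measure.integrableOn_of_bounded measure_Icc_lt_top.ne hf.aestronglyMeasurable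
    (ae_restrict_of_forall_mem measurableSet_Icc hM)

/-- Solvability of linear operator-valued Volterra equations with a strongly measurable kernel. -/
theorem exists_continuous_volterra_solution [CompleteSpace E] [MeasurableSpace E] [BorelSpace E]
    {P : ℝ → E →L[ℝ] E} {C K t₀ T : ℝ} (hT : t₀ ≤ T)
    (hP : Measurable fun p : ℝ × E => P p.1 p.2) (hC : ∀ u, ‖P u‖ ≤ C) (hP0 : ∀ u < 0, P u = 0)
    {D : ℝ → E →L[ℝ] E} (hD : StronglyMeasurable D) (hK : ∀ s, ‖D s‖ ≤ K)
    {G : ℝ → E →L[ℝ] E →L[ℝ] E} (hG : StronglyMeasurable G) (hGi : Integrable G) :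
    ∃ η : C(Icc t₀ T, E →L[ℝ] E →L[ℝ] E), ∀ t : Icc t₀ T, ∀ h k,
      η t h k = (∫ s, P (t - s) (G s h k))
        + ∫ s, P (t - s) ((Icc t₀ T).indicator (fun s => D s (IccExtend hT η s h k)) s) := by
  have hC0 : 0 ≤ C := (norm_nonneg _).trans (hC 0)
  have hK0 : 0 ≤ K := (norm_nonneg _).trans (hK 0)
  let W : C(Icc t₀ T, E →L[ℝ] E →L[ℝ] E) → ℝ → E →L[ℝ] E →L[ℝ] E := fun a =>
    (Icc t₀ T).indicator fun s => (ContinuousLinearMap.compL ℝ E E E (D s)).comp (IccExtend hT a s)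
  have hW_apply : ∀ a s h k,
      W a s h k = (Icc t₀ T).indicator (fun s => D s (IccExtend hT a s h k)) s := by
    intro a s h k
    by_cases hs : s ∈ Icc t₀ T <;> simp [W, hs]
  have hWb : ∀ a : C(Icc t₀ T, E →L[ℝ] E →L[ℝ] E), ∀ s,
      ‖(ContinuousLinearMap.compL ℝ E E E (D s)).comp (IccExtend hT a s)‖ ≤ K * ‖a‖ := by
    intro a s
    refine ContinuousLinearMap.opNorm_le_bound₂ _ (by positivity) fun h k => ?_
    calc ‖D s (IccExtend hT a s h k)‖ ≤ K * (‖a‖ * ‖h‖ * ‖k‖) := by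
          refine (D s).le_of_opNorm_le_of_le (hK s) ?_
          refine (ContinuousLinearMap.le_opNorm₂ _ h k).trans ?_
          gcongr
          exact a.norm_coe_le_norm _
      _ = _ := by ring
  have hWm' : ∀ a : C(Icc t₀ T, E →L[ℝ] E →L[ℝ] E), StronglyMeasurable fun s =>
      (ContinuousLinearMap.compL ℝ E E E (D s)).comp (IccExtend hT a s) := fun a =>
    stronglyMeasurable_compL_comp hD (a.continuous.Icc_extend' (h := hT)).stronglyMeasurable
  have hWm : ∀ a, StronglyMeasurable (W a) := fun a => (hWm' a).indicator measurableSet_Icc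
  have hWi : ∀ a, Integrable (W a) := fun a =>
    (hWm' a).integrable_indicator_Icc fun s _ => hWb a s
  choose J hJc hJ using fun a =>
    exists_continuous_strong_convolution hP hC (hG.add (hWm a)) (hGi.add (hWi a))
  have hint : ∀ {H : ℝ → E →L[ℝ] E →L[ℝ] E}, StronglyMeasurable H → Integrable H →
      ∀ t h k, Integrable fun s => P (t - s) (H s h k) := fun hH hHi t h k =>
    integrable_kernel_apply hP hC (measurable_const.sub measurable_id)
      (_root_.StronglyMeasurable.apply_continuousLinearMap
        (_root_.StronglyMeasurable.apply_continuousLinearMap hH h) k) (hHi.apply_apply h k)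
  have hJ' : ∀ a t h k, J a t h k = (∫ s, P (t - s) (G s h k)) + ∫ s, P (t - s) (W a s h k) := by
    intro a t h k
    rw [hJ, ← integral_add (hint hG hGi t h k) (hint (hWm a) (hWi a) t h k)]
    simp
  let Φ : C(Icc t₀ T, E →L[ℝ] E →L[ℝ] E) → C(Icc t₀ T, E →L[ℝ] E →L[ℝ] E) := fun a =>
    ⟨fun t => J a t, (hJc a).comp continuous_subtype_val⟩
  have hstep : ∀ a b (m : ℝ), 0 ≤ m →
      (∀ t : Icc t₀ T, ‖a t - b t‖ ≤ m * Real.exp ((2 * (C * K) + 1) * (t - t₀))) →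
      ∀ t : Icc t₀ T, ‖Φ a t - Φ b t‖ ≤ m / 2 * Real.exp ((2 * (C * K) + 1) * (t - t₀)) := by
    intro a b m hm hab t
    refine ContinuousLinearMap.opNorm_le_bound₂ _ (by positivity) fun h k => ?_
    have hcont : Continuous fun s =>
        C * K * (m * Real.exp ((2 * (C * K) + 1) * (s - t₀))) * ‖h‖ * ‖k‖ := by fun_prop
    calc ‖(Φ a t - Φ b t) h k‖
        = ‖∫ s, P (t - s) ((W a s - W b s) h k)‖ := by
          simp [Φ, hJ', integral_sub (hint (hWm a) (hWi a) t h k) (hint (hWm b) (hWi b) t h k)]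
      _ ≤ ∫ s, (Icc t₀ (t : ℝ)).indicator (fun s =>
            C * K * (m * Real.exp ((2 * (C * K) + 1) * (s - t₀))) * ‖h‖ * ‖k‖) s := by
          refine norm_integral_le_of_norm_le
            ((integrable_indicator_iff measurableSet_Icc).2 hcont.integrableOn_Icc)
            (.of_forall fun s => ?_)
          by_cases hs : s ∈ Icc t₀ (t : ℝ)
          · have hs' : s ∈ Icc t₀ T := ⟨hs.1, hs.2.trans t.2.2⟩
            rw [indicator_of_mem hs]
            calc ‖P (t - s) ((W a s - W b s) h k)‖
                ≤ C * (K * (m * Real.exp ((2 * (C * K) + 1) * (s - t₀)) * ‖h‖ * ‖k‖)) := by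
                  refine (P _).le_of_opNorm_le_of_le (hC _) ?_
                  simp only [sub_apply, hW_apply,
                    indicator_of_mem hs', IccExtend_of_mem _ _ hs']
                  rw [← map_sub, ← sub_apply, ← sub_apply]
                  exact (D s).le_of_opNorm_le_of_le (hK s)
                    (ContinuousLinearMap.le_of_opNorm₂_le_of_le _ (hab ⟨s, hs'⟩) le_rfl le_rfl)
              _ = _ := by ring
          · rw [indicator_of_notMem hs]
            by_cases hs' : s < t₀
            · simp [W, hs'.not_ge]
            · have : t - s < 0 := by
                by_contra hcon
                exact hs ⟨not_lt.1 hs', by linarith⟩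
              simp [hP0 _ this]
      _ = (C * K * ∫ s in t₀..t, m * Real.exp ((2 * (C * K) + 1) * (s - t₀))) * ‖h‖ * ‖k‖ := by
          rw [integral_indicator measurableSet_Icc, integral_Icc_eq_integral_Ioc,
            ← intervalIntegral.integral_of_le t.2.1]
          simp only [intervalIntegral.integral_mul_const, intervalIntegral.integral_const_mul]
      _ ≤ _ := by
          exact mul_le_mul_of_nonneg_right (mul_le_mul_of_nonneg_right
            (mul_integral_mul_exp_le (mul_nonneg hC0 hK0) hm) (norm_nonneg _)) (norm_nonneg _)
  have hiter : ∀ a b (n : ℕ) (t : Icc t₀ T), ‖Φ^[n] a t - Φ^[n] b t‖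
      ≤ dist a b / 2 ^ n * Real.exp ((2 * (C * K) + 1) * (t - t₀)) := by
    intro a b n
    induction n with
    | zero =>
      intro t
      have h1 : 1 ≤ Real.exp ((2 * (C * K) + 1) * (t - t₀)) :=
        Real.one_le_exp (mul_nonneg (by positivity) (sub_nonneg.2 t.2.1))
      have h2 := ContinuousMap.dist_apply_le_dist (f := a) (g := b) t
      rw [dist_eq_norm] at h2
      simp only [Function.iterate_zero, id, pow_zero, div_one]
      nlinarith [dist_nonneg (x := a) (y := b)]
    | succ n ih =>
      intro t
      rw [Function.iterate_succ_apply', Function.iterate_succ_apply', pow_succ, ← div_div]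
      exact hstep _ _ _ (by positivity) ih t
  obtain ⟨n, hn⟩ := exists_nat_gt (2 * Real.exp ((2 * (C * K) + 1) * (T - t₀)))
  have hcontr : ContractingWith (1 / 2) Φ^[n] := by
    refine ⟨by norm_num, LipschitzWith.of_dist_le_mul fun a b => ?_⟩
    rw [ContinuousMap.dist_le (by positivity)]
    intro t
    rw [dist_eq_norm]
    refine (hiter a b n t).trans ?_
    have h1 : Real.exp ((2 * (C * K) + 1) * (t - t₀)) ≤ 2 ^ n / 2 := by
      have h2 : Real.exp ((2 * (C * K) + 1) * (t - t₀))
          ≤ Real.exp ((2 * (C * K) + 1) * (T - t₀)) := by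
        gcongr
        exact t.2.2
      have h3 : (n : ℝ) < 2 ^ n := by exact_mod_cast Nat.lt_two_pow_self
      linarith
    calc dist a b / 2 ^ n * Real.exp ((2 * (C * K) + 1) * (t - t₀))
        ≤ dist a b / 2 ^ n * (2 ^ n / 2) := by gcongr
      _ = _ := by
        push_cast
        field_simp
  refine ⟨hcontr.fixedPoint, fun t h k => ?_⟩
  have hfix := hcontr.isFixedPt_fixedPoint_iterate
  conv_lhs => rw [← hfix]
  simp only [← hW_apply]
  exact hJ' _ _ _ _

end Volterra

section SecondVariation

set_option maxSynthPendingDepth 3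

open Set

variable {E : Type*} [NormedAddCommGroup E] [NormedSpace ℝ E]

theorem norm_integral_mild_le {S : ℝ → E →L[ℝ] E} {C t₀ T t : ℝ} (ht₀ : 0 ≤ t₀)
    (hS : ∀ u ∈ Icc (0 : ℝ) T, ‖S u‖ ≤ C) (ht : t ∈ Icc t₀ T) {w : ℝ → E} {g : ℝ → ℝ}
    (hg : Continuous g) (hw : ∀ s ∈ Icc t₀ T, ‖w s‖ ≤ g s) :
    ‖∫ s in t₀..t, S (t - s) (w s)‖ ≤ C * ∫ s in t₀..t, g s := by
  rw [← intervalIntegral.integral_const_mul]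
  refine intervalIntegral.norm_integral_le_of_norm_le ht.1 (.of_forall fun s hs => ?_)
    ((hg.const_mul C).intervalIntegrable _ _)
  refine (S _).le_of_opNorm_le_of_le (hS _ ⟨sub_nonneg.2 hs.2, ?_⟩)
    (hw s ⟨hs.1.le, hs.2.trans ht.2⟩)
  linarith [hs.1, ht.2]

theorem integral_indicator_kernel {S : ℝ → E →L[ℝ] E} {t₀ T t : ℝ} (ht₀ : 0 ≤ t₀)
    (ht : t ∈ Icc t₀ T) (w : ℝ → E) :
    ∫ s, (Icc (0 : ℝ) T).indicator S (t - s) ((Icc t₀ T).indicator w s)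
      = ∫ s in t₀..t, S (t - s) (w s) := by
  rw [intervalIntegral.integral_of_le ht.1, ← integral_Icc_eq_integral_Ioc,
    ← integral_indicator measurableSet_Icc]
  congr 1 with s
  by_cases hs : s ∈ Icc t₀ t
  · rw [indicator_of_mem hs, indicator_of_mem (show s ∈ Icc t₀ T from ⟨hs.1, hs.2.trans ht.2⟩),
      indicator_of_mem (show t - s ∈ Icc (0 : ℝ) T from
        ⟨sub_nonneg.2 hs.2, by linarith [hs.1, ht.2]⟩)]
  · rw [indicator_of_notMem hs]
    by_cases hs' : t₀ ≤ s
    · rw [indicator_of_notMem (a := t - s) fun h => hs ⟨hs', sub_nonneg.1 h.1⟩]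
      rfl
    · rw [indicator_of_notMem (a := s) fun h => hs' h.1, map_zero]

theorem intervalIntegrable_mild [MeasurableSpace E] [BorelSpace E] {S : ℝ → E →L[ℝ] E}
    {C t₀ T t M : ℝ} (ht₀ : 0 ≤ t₀) (hSm : Measurable fun p : ℝ × E => S p.1 p.2)
    (hS : ∀ u ∈ Icc (0 : ℝ) T, ‖S u‖ ≤ C) (ht : t ∈ Icc t₀ T) {w : ℝ → E}
    (hw : StronglyMeasurable w) (hM : ∀ s ∈ Icc t₀ T, ‖w s‖ ≤ M) :
    IntervalIntegrable (fun s => S (t - s) (w s)) volume t₀ t := by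
  rw [intervalIntegrable_iff_integrableOn_Ioc_of_le ht.1]
  refine Measure.integrableOn_of_bounded (M := C * M) measure_Ioc_lt_top.ne
    (stronglyMeasurable_kernel_apply hSm (measurable_const.sub measurable_id)
      hw).aestronglyMeasurable
    (ae_restrict_of_forall_mem measurableSet_Ioc fun s hs => ?_)
  refine (S _).le_of_opNorm_le_of_le (hS _ ⟨sub_nonneg.2 hs.2, ?_⟩)
    (hM s ⟨hs.1.le, hs.2.trans ht.2⟩)
  linarith [hs.1, ht.2]

theorem BddMeasOn.stronglyMeasurable_IccExtend {F : Type*} [NormedAddCommGroup F]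
    [MeasurableSpace F] [BorelSpace F] {f : ℝ → F} {t₀ T : ℝ} (hf : BddMeasOn f t₀ T)
    (hT : t₀ ≤ T) : StronglyMeasurable (IccExtend hT fun t : Icc t₀ T => f t) :=
  (hf.1.comp continuous_projIcc.measurable).stronglyMeasurable_of_standardBorel

theorem stronglyMeasurable_along {E F : Type*} [NormedAddCommGroup E] [MeasurableSpace E]
    [BorelSpace E] [NormedAddCommGroup F] [MeasurableSpace F] [BorelSpace F]
    {B : ℝ → E → F} {Y : ℝ → E} {t₀ T : ℝ} (hB : Measurable fun p : ℝ × E => B p.1 p.2)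
    (hT : t₀ ≤ T) (hY : BddMeasOn Y t₀ T) :
    StronglyMeasurable fun s => B s (IccExtend hT (fun t : Icc t₀ T => Y t) s) :=
  (hB.comp (measurable_id.prodMk
    (hY.stronglyMeasurable_IccExtend hT).measurable)).stronglyMeasurable_of_standardBorel

theorem IsFirstVariation.norm_le {S : ℝ → E →L[ℝ] E} {DB : ℝ → E → E →L[ℝ] E}
    {C K t₀ T : ℝ} {Y : ℝ → E} {ξ : ℝ → E →L[ℝ] E} (ht₀ : 0 ≤ t₀) (hT : t₀ ≤ T)
    (hS : ∀ u ∈ Icc (0 : ℝ) T, ‖S u‖ ≤ C) (hK : ∀ t x, ‖DB t x‖ ≤ K)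
    (hξ : IsFirstVariation S DB t₀ T Y ξ) {M : ℝ} (hM : ∀ t ∈ Icc t₀ T, ‖ξ t‖ ≤ M) :
    ∀ t ∈ Icc t₀ T, ‖ξ t‖ ≤ 2 * C * Real.exp ((2 * (C * K) + 1) * T) := by
  have hC0 : 0 ≤ C := (norm_nonneg _).trans (hS 0 ⟨le_rfl, ht₀.trans hT⟩)
  have hK0 : 0 ≤ K := (norm_nonneg _).trans (hK 0 0)
  intro t ht
  refine (le_exp_of_le_integral_majorant hC0 (mul_nonneg hC0 hK0) hM ?_ t ht).trans ?_
  · intro g hg hξg t ht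
    have hg0 : 0 ≤ ∫ s in t₀..t, g s := intervalIntegral.integral_nonneg ht.1 fun s hs =>
      (norm_nonneg _).trans (hξg s ⟨hs.1, hs.2.trans ht.2⟩)
    refine ContinuousLinearMap.opNorm_le_bound _ (by positivity) fun h => ?_
    have h1 := norm_integral_mild_le (w := fun s => DB s (Y s) (ξ s h))
      (g := fun s => K * (g s * ‖h‖)) ht₀ hS ht (by fun_prop) fun s hs =>
        (DB s (Y s)).le_of_opNorm_le_of_le (hK _ _) ((ξ s).le_of_opNorm_le (hξg s hs) h)
    simp only [intervalIntegral.integral_mul_const, intervalIntegral.integral_const_mul] at h1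
    have h2 : ‖S (t - t₀) h‖ ≤ C * ‖h‖ :=
      (S _).le_of_opNorm_le (hS _ ⟨sub_nonneg.2 ht.1, by linarith [ht.2]⟩) h
    rw [hξ t ht h]
    refine (norm_add_le _ _).trans ((add_le_add h2 h1).trans_eq ?_)
    ring
  · gcongr
    linarith [ht.2]

variable {S : ℝ → E →L[ℝ] E} {DB : ℝ → E → E →L[ℝ] E} {D2B : ℝ → E → E →L[ℝ] E →L[ℝ] E}
  {C K M X t₀ T : ℝ} {Y : ℝ → E} {ξ : ℝ → E →L[ℝ] E}

theorem norm_apply_apply_le_of_norm_le {A : E →L[ℝ] E →L[ℝ] E} {ξ : E →L[ℝ] E} (hA : ‖A‖ ≤ M)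
    (hξ : ‖ξ‖ ≤ X) (h k : E) : ‖A (ξ h) (ξ k)‖ ≤ M * X ^ 2 * ‖h‖ * ‖k‖ := by
  refine (A.le_of_opNorm₂_le_of_le hA (ξ.le_of_opNorm_le hξ h)
    (ξ.le_of_opNorm_le hξ k)).trans_eq ?_
  ring

theorem IsSecondVariation.norm_le (ht₀ : 0 ≤ t₀) (hT : t₀ ≤ T)
    (hS : ∀ u ∈ Icc (0 : ℝ) T, ‖S u‖ ≤ C) (hK : ∀ t x, ‖DB t x‖ ≤ K)
    (hM : ∀ t x, ‖D2B t x‖ ≤ M) (hξ : ∀ t ∈ Icc t₀ T, ‖ξ t‖ ≤ X)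
    {η : ℝ → E →L[ℝ] E →L[ℝ] E} (hη : IsSecondVariation S DB D2B t₀ T Y ξ η) {N : ℝ}
    (hN : ∀ t ∈ Icc t₀ T, ‖η t‖ ≤ N) :
    ∀ t ∈ Icc t₀ T, ‖η t‖ ≤ 2 * (C * (T * (M * X ^ 2))) * Real.exp ((2 * (C * K) + 1) * T) := by
  have hC0 : 0 ≤ C := (norm_nonneg _).trans (hS 0 ⟨le_rfl, ht₀.trans hT⟩)
  have hK0 : 0 ≤ K := (norm_nonneg _).trans (hK 0 0)
  have hM0 : 0 ≤ M := (norm_nonneg _).trans (hM 0 0)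
  have hT0 : 0 ≤ T := ht₀.trans hT
  intro t ht
  refine (le_exp_of_le_integral_majorant (A := C * (T * (M * X ^ 2))) (by positivity)
    (mul_nonneg hC0 hK0) hN ?_ t ht).trans ?_
  · intro g hg hηg t ht
    have hg0 : 0 ≤ ∫ s in t₀..t, g s := intervalIntegral.integral_nonneg ht.1 fun s hs =>
      (norm_nonneg _).trans (hηg s ⟨hs.1, hs.2.trans ht.2⟩)
    refine ContinuousLinearMap.opNorm_le_bound₂ _ (by positivity) fun h k => ?_
    have h1 := norm_integral_mild_le (w := fun s => DB s (Y s) (η s h k))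
      (g := fun s => K * (g s * ‖h‖ * ‖k‖)) ht₀ hS ht (by fun_prop) fun s hs =>
        (DB s (Y s)).le_of_opNorm_le_of_le (hK _ _)
          ((η s).le_of_opNorm₂_le_of_le (hηg s hs) le_rfl le_rfl)
    have h2 := norm_integral_mild_le (w := fun s => D2B s (Y s) (ξ s h) (ξ s k))
      (g := fun _ => M * X ^ 2 * ‖h‖ * ‖k‖) ht₀ hS ht (by fun_prop) fun s hs =>
        norm_apply_apply_le_of_norm_le (hM s (Y s)) (hξ s hs) h k
    simp only [intervalIntegral.integral_mul_const, intervalIntegral.integral_const_mul,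
      intervalIntegral.integral_const, smul_eq_mul] at h1 h2
    have h3 : C * ((t - t₀) * M * X ^ 2 * ‖h‖ * ‖k‖) ≤ C * (T * M * X ^ 2 * ‖h‖ * ‖k‖) := by
      gcongr
      linarith [ht.2]
    rw [hη t ht h k]
    refine (norm_add_le _ _).trans ((add_le_add (h2.trans h3) h1).trans_eq ?_)
    ring
  · gcongr
    linarith [ht.2]

variable [MeasurableSpace E] [BorelSpace E]

theorem IsSecondVariation.eqOn (ht₀ : 0 ≤ t₀) (hT : t₀ ≤ T)
    (hSm : Measurable fun p : ℝ × E => S p.1 p.2)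
    (hS : ∀ u ∈ Icc (0 : ℝ) T, ‖S u‖ ≤ C) (hDB : Measurable fun p : ℝ × E => DB p.1 p.2)
    (hK : ∀ t x, ‖DB t x‖ ≤ K) (hY : BddMeasOn Y t₀ T)
    {η₁ η₂ : ℝ → E →L[ℝ] E →L[ℝ] E}
    (hb₁ : BddMeasOn η₁ t₀ T) (hη₁ : IsSecondVariation S DB D2B t₀ T Y ξ η₁)
    (hb₂ : BddMeasOn η₂ t₀ T) (hη₂ : IsSecondVariation S DB D2B t₀ T Y ξ η₂) :
    EqOn η₁ η₂ (Icc t₀ T) := by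
  have hint : ∀ {η : ℝ → E →L[ℝ] E →L[ℝ] E}, BddMeasOn η t₀ T → ∀ t ∈ Icc t₀ T, ∀ h k,
      IntervalIntegrable (fun s => S (t - s) (DB s (Y s) (η s h k))) volume t₀ t := by
    intro η hη t ht h k
    obtain ⟨N, hN⟩ := hη.2
    have hw : StronglyMeasurable fun s => DB s (IccExtend hT (fun t : Icc t₀ T => Y t) s)
        (IccExtend hT (fun t : Icc t₀ T => η t) s h k) :=
      isBoundedBilinearMap_apply.continuous.comp_stronglyMeasurable
        ((stronglyMeasurable_along hDB hT hY).prodMk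
          (_root_.StronglyMeasurable.apply_continuousLinearMap
            (_root_.StronglyMeasurable.apply_continuousLinearMap
              (hη.stronglyMeasurable_IccExtend hT) h) k))
    have := intervalIntegrable_mild (M := K * (N * ‖h‖ * ‖k‖)) ht₀ hSm hS ht hw fun s hs => by
      rw [IccExtend_of_mem _ _ hs, IccExtend_of_mem _ _ hs]
      exact (DB s _).le_of_opNorm_le_of_le (hK _ _)
        ((η s).le_of_opNorm₂_le_of_le (hN s hs) le_rfl le_rfl)
    refine this.congr fun s hs => ?_
    rw [uIoc_of_le ht.1] at hs
    have hs' : s ∈ Icc t₀ T := ⟨hs.1.le, hs.2.trans ht.2⟩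
    simp only [IccExtend_of_mem _ _ hs']
  obtain ⟨N₁, hN₁⟩ := hb₁.2
  obtain ⟨N₂, hN₂⟩ := hb₂.2
  have hdiff : IsSecondVariation S DB (fun _ _ => 0) t₀ T Y (fun _ => 0) fun t => η₁ t - η₂ t := by
    intro t ht h k
    have := intervalIntegral.integral_sub (hint hb₁ t ht h k) (hint hb₂ t ht h k)
    simp only [sub_apply, map_sub, hη₁ t ht h k, hη₂ t ht h k, this]
    simp
  intro t ht
  have := hdiff.norm_le (M := 0) (X := 0) ht₀ hT hS hK (by simp) (by simp)
    (fun t ht => (norm_sub_le _ _).trans (add_le_add (hN₁ t ht) (hN₂ t ht))) t ht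
  simpa [sub_eq_zero] using this

theorem IsSecondVariation.exists_bddMeasOn [CompleteSpace E] (ht₀ : 0 ≤ t₀) (hT : t₀ ≤ T)
    (hSm : Measurable fun p : ℝ × E => S p.1 p.2)
    (hS : ∀ u ∈ Icc (0 : ℝ) T, ‖S u‖ ≤ C) (hDB : Measurable fun p : ℝ × E => DB p.1 p.2)
    (hK : ∀ t x, ‖DB t x‖ ≤ K) (hD2B : Measurable fun p : ℝ × E => D2B p.1 p.2)
    (hM : ∀ t x, ‖D2B t x‖ ≤ M) (hY : BddMeasOn Y t₀ T) (hξ : BddMeasOn ξ t₀ T) :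
    ∃ η : ℝ → E →L[ℝ] E →L[ℝ] E,
      BddMeasOn η t₀ T ∧ IsSecondVariation S DB D2B t₀ T Y ξ η := by
  obtain ⟨X, hX⟩ := hξ.2
  have hT0 : (0 : ℝ) ∈ Icc (0 : ℝ) T := ⟨le_rfl, ht₀.trans hT⟩
  let Y' := IccExtend hT fun t : Icc t₀ T => Y t
  let ξ' := IccExtend hT fun t : Icc t₀ T => ξ t
  have hξm : StronglyMeasurable ξ' := hξ.stronglyMeasurable_IccExtend hT
  let P : ℝ → E →L[ℝ] E := (Icc (0 : ℝ) T).indicator S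
  have hP : Measurable fun p : ℝ × E => P p.1 p.2 := by
    have : (fun p : ℝ × E => P p.1 p.2)
        = (Prod.fst ⁻¹' Icc (0 : ℝ) T).indicator fun p => S p.1 p.2 := by
      ext p
      by_cases hp : p.1 ∈ Icc (0 : ℝ) T
      · rw [indicator_of_mem (show p ∈ Prod.fst ⁻¹' Icc (0 : ℝ) T from hp)]
        simp only [P, indicator_of_mem hp]
      · rw [indicator_of_notMem (show p ∉ Prod.fst ⁻¹' Icc (0 : ℝ) T from hp)]
        simp only [P, indicator_of_notMem hp, zero_apply]
    rw [this]
    exact hSm.indicator (measurable_fst measurableSet_Icc)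
  have hPC : ∀ u, ‖P u‖ ≤ C := fun u => by
    by_cases hu : u ∈ Icc (0 : ℝ) T
    · simpa only [P, indicator_of_mem hu] using hS u hu
    · simpa only [P, indicator_of_notMem hu, norm_zero] using (norm_nonneg _).trans (hS 0 hT0)
  have hP0 : ∀ u < 0, P u = 0 := fun u hu => indicator_of_notMem (fun h => hu.not_ge h.1) _
  let G : ℝ → E →L[ℝ] E →L[ℝ] E := fun s =>
    (ContinuousLinearMap.compL ℝ E E E).flip (ξ' s) ∘L (D2B s (Y' s) ∘L ξ' s)
  have hG : StronglyMeasurable G := by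
    have hc : Continuous fun p : (E →L[ℝ] E →L[ℝ] E) × (E →L[ℝ] E) =>
        (ContinuousLinearMap.compL ℝ E E E).flip p.2 ∘L (p.1 ∘L p.2) := by fun_prop
    exact hc.comp_stronglyMeasurable ((stronglyMeasurable_along hD2B hT hY).prodMk hξm)
  have hGM : ∀ s ∈ Icc t₀ T, ‖G s‖ ≤ M * X ^ 2 := fun s hs => by
    have hM0 : 0 ≤ M := (norm_nonneg _).trans (hM 0 0)
    refine ContinuousLinearMap.opNorm_le_bound₂ _ (by positivity) fun h k => ?_
    refine norm_apply_apply_le_of_norm_le (hM s (Y' s)) ?_ h k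
    simpa only [ξ', IccExtend_of_mem _ _ hs] using hX s hs
  obtain ⟨η, hη⟩ := exists_continuous_volterra_solution hT hP hPC hP0
    (stronglyMeasurable_along hDB hT hY) (fun s => hK s _) (hG.indicator measurableSet_Icc)
    (hG.integrable_indicator_Icc hGM)
  have hcongr : ∀ t ∈ Icc t₀ T, ∀ w w' : ℝ → E, EqOn w w' (Icc t₀ T) →
      ∫ s in t₀..t, S (t - s) (w s) = ∫ s in t₀..t, S (t - s) (w' s) := by
    intro t ht w w' hw
    refine intervalIntegral.integral_congr fun s hs => ?_
    rw [uIcc_of_le ht.1] at hs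
    simp only [hw ⟨hs.1, hs.2.trans ht.2⟩]
  refine ⟨IccExtend hT η, ⟨?_, ‖η‖, fun t _ => η.norm_coe_le_norm _⟩, fun t ht h k => ?_⟩
  · have hc : Continuous fun t : Icc t₀ T => IccExtend hT η t :=
      η.continuous.Icc_extend'.comp continuous_subtype_val
    exact hc.measurable
  · have hGind : ∀ s, (Icc t₀ T).indicator G s h k = (Icc t₀ T).indicator (fun s => G s h k) s := by
      intro s
      by_cases hs : s ∈ Icc t₀ T
      · simp only [indicator_of_mem hs]
      · simp only [indicator_of_notMem hs, zero_apply]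
    have := hη ⟨t, ht⟩ h k
    simp only [hGind] at this
    rw [integral_indicator_kernel ht₀ ht, integral_indicator_kernel ht₀ ht] at this
    rw [IccExtend_of_mem _ _ ht, this]
    congr 1
    · refine hcongr t ht _ _ fun s hs => ?_
      simp only [G, ξ', Y', IccExtend_of_mem _ _ hs]
      rfl
    · refine hcongr t ht _ _ fun s hs => ?_
      simp only [IccExtend_of_mem _ _ hs]

end SecondVariation

/-- There is a unique bounded measurable
`η^{t₀,y} : [t₀,T] → L(E,E;E)` solving the second variation equation, and it is
bounded by a constant `C_η` depending only on `C_A`, `K_B`, `M_B` and `T`. -/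
theorem second_variation_exists_unique_bounded (C_A K_B M_B T : ℝ) :
    ∃ Cη : ℝ, ∀ (E : Type u) [NormedAddCommGroup E] [NormedSpace ℝ E] [CompleteSpace E]
      [MeasurableSpace E] [BorelSpace E],
      ∀ (t₀ : ℝ), 0 < T → t₀ ∈ Set.Ico (0:ℝ) T →
      ∀ S : ℝ → E →L[ℝ] E,
        S 0 = ContinuousLinearMap.id ℝ E →
        (∀ s t : ℝ, 0 ≤ s → 0 ≤ t → s + t ≤ T → (S t).comp (S s) = S (s + t)) →
        (∀ t ∈ Set.Icc (0:ℝ) T, ‖S t‖ ≤ C_A) →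
        (Measurable fun p : ℝ × E => S p.1 p.2) →
      ∀ (B : ℝ → E → E) (DB : ℝ → E → E →L[ℝ] E)
        (D2B : ℝ → E → E →L[ℝ] E →L[ℝ] E) (Bsup : ℝ),
        Measurable (Function.uncurry B) →
        (Measurable fun p : ℝ × E => DB p.1 p.2) →
        (Measurable fun p : ℝ × E => D2B p.1 p.2) →
        (∀ t x, ‖B t x‖ ≤ Bsup) →
        (∀ t x, HasFDerivAt (B t) (DB t x) x) →
        (∀ t x, ‖DB t x‖ ≤ K_B) →
        (∀ t x, HasFDerivAt (fun w => DB t w) (D2B t x) x) →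
        (∀ t x, ‖D2B t x‖ ≤ M_B) →
      ∀ z : ℝ → E, BddMeasOn z t₀ T →
      ∀ (y : E) (Y : ℝ → E) (ξ : ℝ → E →L[ℝ] E),
        BddMeasOn Y t₀ T → IsMildSolution S B t₀ T y z Y →
        BddMeasOn ξ t₀ T → IsFirstVariation S DB t₀ T Y ξ →
        (∃ η : ℝ → E →L[ℝ] E →L[ℝ] E,
          BddMeasOn η t₀ T ∧ IsSecondVariation S DB D2B t₀ T Y ξ η) ∧
        (∀ η₁ η₂ : ℝ → E →L[ℝ] E →L[ℝ] E,
          BddMeasOn η₁ t₀ T → IsSecondVariation S DB D2B t₀ T Y ξ η₁ →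
          BddMeasOn η₂ t₀ T → IsSecondVariation S DB D2B t₀ T Y ξ η₂ →
          Set.EqOn η₁ η₂ (Set.Icc t₀ T)) ∧
        (∀ η : ℝ → E →L[ℝ] E →L[ℝ] E,
          BddMeasOn η t₀ T → IsSecondVariation S DB D2B t₀ T Y ξ η →
          ∀ t ∈ Set.Icc t₀ T, ‖η t‖ ≤ Cη) := by
  refine ⟨2 * (C_A * (T * (M_B * (2 * C_A * Real.exp ((2 * (C_A * K_B) + 1) * T)) ^ 2)))
    * Real.exp ((2 * (C_A * K_B) + 1) * T), ?_⟩
  intro E _ _ _ _ _ t₀ _ ht₀ S _ _ hS hSm B DB D2B _ _ hDB hD2B _ _ hK _ hM z _ y Y ξ hY _ hξ hξeq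
  have hT := ht₀.2.le
  obtain ⟨X, hX⟩ := hξ.2
  refine ⟨IsSecondVariation.exists_bddMeasOn ht₀.1 hT hSm hS hDB hK hD2B hM hY hξ,
    fun η₁ η₂ hb₁ hη₁ hb₂ hη₂ => hη₁.eqOn ht₀.1 hT hSm hS hDB hK hY hb₁ hb₂ hη₂, fun η hb hη => ?_⟩
  obtain ⟨N, hN⟩ := hb.2
  exact hη.norm_le ht₀.1 hT hS hK hM (hξeq.norm_le ht₀.1 hT hS hK hX) hN
end
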